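/- arXiv:1406.2269 — 2 statements merged into one kernel-verified Lean document; each statement's English description precedes it below -/
import Mathlib

section
/- Uniqueness characterization of the gain function: if C : [0,1] × [0,1] → ℝ satisfies (i) C(x, x) = 0 for all 0 ≤ x < 1, (ii) C(0, y) = y for all 0 ≤ y ≤ 1, and (iii) C(x, z) = C(x, y) + C(y, z) − C(x, y)·C(y, z) for all 0 ≤ x, y < 1 and 0 ≤ z ≤ 1, then C(x, y) = (y − x)/(1 − x) for all 0 ≤ x < 1 and 0 ≤ y ≤ 1. -/
/-- Uniqueness characterization of the gain function: any `C` satisfying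
(i) `C(x,x) = 0` for `0 ≤ x < 1`, (ii) `C(0,y) = y` for `0 ≤ y ≤ 1`, and
(iii) `C(x,z) = C(x,y) + C(y,z) − C(x,y)·C(y,z)` for `0 ≤ x, y < 1`,
`0 ≤ z ≤ 1`, equals `(y − x)/(1 − x)` on `0 ≤ x < 1`, `0 ≤ y ≤ 1`. -/
theorem gain_unique (C : ℝ → ℝ → ℝ)
    (h1 : ∀ x : ℝ, 0 ≤ x → x < 1 → C x x = 0)
    (h2 : ∀ y : ℝ, 0 ≤ y → y ≤ 1 → C 0 y = y)
    (h3 : ∀ x y z : ℝ, 0 ≤ x → x < 1 → 0 ≤ y → y < 1 → 0 ≤ z → z ≤ 1 →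
      C x z = C x y + C y z - C x y * C y z) :
    ∀ x y : ℝ, 0 ≤ x → x < 1 → 0 ≤ y → y ≤ 1 →
      C x y = (y - x) / (1 - x) := by
  intro x y hx hx1 hy hy1
  have h := h3 0 x y le_rfl one_pos hx hx1 hy hy1
  rw [h2 x hx hx1.le, h2 y hy hy1] at h
  rw [eq_div_iff (sub_pos.mpr hx1).ne']
  linear_combination -h
end

section
/- Uniqueness of the logarithmic difference among additive change functions: if C : (0,∞) × (0,∞) → ℝ satisfies C(λx, λy) = C(x, y) for all λ > 0, the additivity property C(x, z) = C(x, y) + C(y, z) for all positive x, y, z, and for each fixed x the map y ↦ C(x, y) is continuous and strictly increasing, then there exists a constant c > 0 such that C(x, y) = c·log(y/x) for all x, y > 0. -/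
/-- Uniqueness of the logarithmic difference among additive change functions:
a scale-invariant, additive function `C` that is continuous and strictly
increasing in its second argument is `c·log(y/x)` for some `c > 0`. -/
theorem log_difference_unique (C : ℝ → ℝ → ℝ)
    (hscale : ∀ x y l : ℝ, 0 < x → 0 < y → 0 < l → C (l * x) (l * y) = C x y)
    (hadd : ∀ x y z : ℝ, 0 < x → 0 < y → 0 < z → C x z = C x y + C y z)
    (hcont : ∀ x : ℝ, 0 < x → ContinuousOn (fun y : ℝ => C x y) (Set.Ioi (0 : ℝ)))
    (hmono : ∀ x : ℝ, 0 < x → StrictMonoOn (fun y : ℝ => C x y) (Set.Ioi (0 : ℝ))) :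
    ∃ c : ℝ, 0 < c ∧ ∀ x y : ℝ, 0 < x → 0 < y → C x y = c * Real.log (y / x) := by
  have hzero : C 1 1 = 0 := by
    linarith [hadd 1 1 1 one_pos one_pos one_pos]
  let f : ℝ →+ ℝ :=
    { toFun := fun t => C 1 (Real.exp t)
      map_zero' := by simpa using hzero
      map_add' := fun s t => by
        have hs := Real.exp_pos s
        have ht := Real.exp_pos t
        have h := hscale 1 (Real.exp t) (Real.exp s) one_pos ht hs
        rw [mul_one] at h
        rw [Real.exp_add, hadd 1 (Real.exp s) _ one_pos hs (mul_pos hs ht), h] }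
  have hf : Continuous f :=
    (hcont 1 one_pos).comp_continuous Real.continuous_exp Real.exp_pos
  refine ⟨f 1, ?_, fun x y hx hy => ?_⟩
  · have h := hmono 1 one_pos (Set.mem_Ioi.2 one_pos) (Real.exp_pos 1)
      (Real.one_lt_exp_iff.2 one_pos)
    exact hzero.symm.trans_lt h
  · have hyx : 0 < y / x := div_pos hy hx
    have h := map_real_smul f hf (Real.log (y / x)) 1
    rw [smul_eq_mul, smul_eq_mul, mul_one] at h
    rw [mul_comm, ← h]
    change C x y = C 1 (Real.exp (Real.log (y / x)))
    rw [Real.exp_log hyx, ← hscale 1 (y / x) x one_pos hyx hx, mul_one,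
      mul_div_cancel₀ _ hx.ne']
end
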